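/- arXiv:1705.04640 — 2 statements merged into one kernel-verified Lean document; each statement's English description precedes it below -/
import Mathlib

section
/- Let k ≥ 4 be an integer. For every red-blue colouring of the k-dimensional Euclidean space ℝ^k (given by a set R ⊆ ℝ^k of red points, all other points being blue), either there exist two red points at distance exactly 1 from each other, or there exist a point p ∈ ℝ^k and a vector v ∈ ℝ^k with ‖v‖ = 1 such that the k+3 points p, p + v, p + 2v, …, p + (k+2)v are all blue. -/
/-- the colouring induced by the position of the first red point on a line (Szlam). -/
lemma szlam {k : ℕ} (R : Set (EuclideanSpace ℝ (Fin k))) (m : ℕ) {ι : Type*}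
    (f : ι → EuclideanSpace ℝ (Fin k)) (v : EuclideanSpace ℝ (Fin k)) (hv : ‖v‖ = 1)
    (hR : ∀ x ∈ R, ∀ y ∈ R, dist x y ≠ 1)
    (hl : ∀ p v : EuclideanSpace ℝ (Fin k), ‖v‖ = 1 → ∃ i < m, p + (i : ℝ) • v ∈ R) :
    ∃ c : ι → ℕ, (∀ i, c i < m) ∧ ∀ i j, dist (f i) (f j) = 1 → c i ≠ c j := by
  choose c hc hcR using fun i => hl (f i) v hv
  refine ⟨c, hc, fun i j hd he => ?_⟩
  apply hR _ (hcR i) _ (hcR j)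
  rw [he, dist_add_right, hd]

lemma two_dirs {k : ℕ} (hk : 2 ≤ k) (m : ℕ) (hm : 0 < m) :
    ∃ u v : EuclideanSpace ℝ (Fin k), ‖u‖ = 1 ∧ ‖v‖ = 1 ∧
      dist ((m : ℝ) • u) ((m : ℝ) • v) = 1 := by
  obtain ⟨n, rfl⟩ : ∃ n, k = n + 2 := ⟨k - 2, by omega⟩
  have hm' : (1 : ℝ) ≤ m := by exact_mod_cast hm
  set s : ℝ := 1 / (2 * m) with hs
  have hs0 : 0 < s := by positivity
  have hs1 : s ≤ 1 / 2 := by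
    rw [hs]; apply one_div_le_one_div_of_le <;> linarith
  have hc : Real.sqrt (1 - s ^ 2) ^ 2 = 1 - s ^ 2 := Real.sq_sqrt (by nlinarith)
  set c := Real.sqrt (1 - s ^ 2)
  refine ⟨WithLp.toLp 2 (Fin.cons c (Fin.cons s 0)), WithLp.toLp 2 (Fin.cons c (Fin.cons (-s) 0)),
    ?_, ?_, ?_⟩
  · rw [EuclideanSpace.norm_eq]
    simp [Fin.sum_univ_succ, hc]
  · rw [EuclideanSpace.norm_eq]
    simp [Fin.sum_univ_succ, hc]
  · rw [EuclideanSpace.dist_eq]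
    simp [Fin.sum_univ_succ, Real.dist_eq]
    rw [← mul_add, ← two_mul]
    left
    rw [hs]
    field_simp

/-- the fractional version, including the equality case. -/
lemma frac {k : ℕ} (hk : 2 ≤ k) (R : Set (EuclideanSpace ℝ (Fin k))) (m a : ℕ)
    {ι : Type*} [Fintype ι] [DecidableEq ι] [Nonempty ι]
    (f : ι → EuclideanSpace ℝ (Fin k))
    (hcard : m * a ≤ Fintype.card ι)
    (hα : ∀ S : Finset ι, (∀ i ∈ S, ∀ j ∈ S, i ≠ j → dist (f i) (f j) ≠ 1) → S.card ≤ a)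
    (hR : ∀ x ∈ R, ∀ y ∈ R, dist x y ≠ 1)
    (hl : ∀ p v : EuclideanSpace ℝ (Fin k), ‖v‖ = 1 → ∃ i < m, p + (i : ℝ) • v ∈ R) :
    False := by
  classical
  have huniq : ∀ p v : EuclideanSpace ℝ (Fin k), ‖v‖ = 1 → ∀ j₁ < m, ∀ j₂ < m,
      p + (j₁ : ℝ) • v ∈ R → p + (j₂ : ℝ) • v ∈ R → j₁ = j₂ := by
    intro p v hv j₁ hj₁ j₂ hj₂ h₁ h₂
    by_contra hne
    obtain ⟨i₀⟩ := ‹Nonempty ι›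
    let P : ι → ℕ → Prop := fun i j => (p - f i₀) + f i + (j : ℝ) • v ∈ R
    have e1 : ∑ i : ι, ((Finset.range m).filter (fun j => P i j)).card =
        ∑ j ∈ Finset.range m, ((Finset.univ : Finset ι).filter (fun i => P i j)).card := by
      simp only [Finset.card_filter]
      exact Finset.sum_comm
    have e2 : ∑ j ∈ Finset.range m, ((Finset.univ : Finset ι).filter (fun i => P i j)).card
        ≤ m * a := by
      calc _ ≤ ∑ j ∈ Finset.range m, a := by
            apply Finset.sum_le_sum
            intro j _
            apply hα
            intro i hi i' hi' _ hd
            simp only [Finset.mem_filter, P] at hi hi'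
            apply hR _ hi.2 _ hi'.2
            rw [dist_add_right, dist_add_left, hd]
        _ = m * a := by simp
    have e3 : ∑ i : ι, 1 < ∑ i : ι, ((Finset.range m).filter (fun j => P i j)).card := by
      apply Finset.sum_lt_sum
      · intro i _
        obtain ⟨j, hj, hjR⟩ := hl ((p - f i₀) + f i) v hv
        exact Finset.card_pos.mpr ⟨j, by simp [P, hj, hjR]⟩
      · refine ⟨i₀, Finset.mem_univ _, ?_⟩
        apply Finset.one_lt_card.mpr
        refine ⟨j₁, ?_, j₂, ?_, hne⟩
        · simp [P, hj₁, h₁]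
        · simp [P, hj₂, h₂]
    simp at e3
    omega
  have hm : 0 < m := by
    obtain ⟨u, v, hu, _⟩ := two_dirs hk 1 one_pos
    obtain ⟨i, hi, _⟩ := hl 0 u hu
    omega
  obtain ⟨u, v, hu, hv, huv⟩ := two_dirs hk m hm
  obtain ⟨i, hi, hy⟩ := hl 0 u hu
  set y := 0 + (i : ℝ) • u
  have key : ∀ w : EuclideanSpace ℝ (Fin k), ‖w‖ = 1 → y + (m : ℝ) • w ∈ R := by
    intro w hw
    obtain ⟨j, hj, hjR⟩ := hl (y + w) w hw
    have e : y + w + (j : ℝ) • w = y + ((j + 1 : ℕ) : ℝ) • w := by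
      push_cast; module
    rw [e] at hjR
    by_cases h : j + 1 = m
    · rwa [h] at hjR
    · have := huniq y w hw 0 hm (j + 1) (by omega) (by simpa using hy) hjR
      omega
  exact hR _ (key u hu) _ (key v hv) (by rw [dist_add_left, huv])

/-- integer vectors with a diagonal quadratic form, rescaled. -/
noncomputable def emb {k : ℕ} (w : Fin k → ℕ) (D : ℕ) (a : Fin k → ℤ) :
    EuclideanSpace ℝ (Fin k) :=
  WithLp.toLp 2 (fun i => Real.sqrt ((w i : ℝ) / D) * (a i : ℝ))

lemma emb_dist {k : ℕ} (w : Fin k → ℕ) (D : ℕ) (hD : 0 < D) (a b : Fin k → ℤ) :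
    dist (emb w D a) (emb w D b) = 1 ↔ ∑ i, (w i : ℤ) * (a i - b i) ^ 2 = D := by
  have hD' : (0 : ℝ) < D := by exact_mod_cast hD
  have h : ∑ i, dist (emb w D a i) (emb w D b i) ^ 2 =
      ((∑ i, (w i : ℤ) * (a i - b i) ^ 2 : ℤ) : ℝ) / D := by
    push_cast
    rw [Finset.sum_div]
    apply Finset.sum_congr rfl
    intro i _
    simp only [emb]
    rw [Real.dist_eq, sq_abs, ← mul_sub, mul_pow, Real.sq_sqrt (by positivity)]
    ring
  rw [EuclideanSpace.dist_eq, h, Real.sqrt_eq_one, div_eq_one_iff_eq hD'.ne']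
  exact_mod_cast Iff.rfl

/-- the independence bound coming from positivity of the Gram matrix. -/
lemma gram_bound {k : ℕ} (w : Fin k → ℕ) {ι : Type*} [DecidableEq ι] (a : ι → Fin k → ℤ)
    (A B : ℤ) (S : Finset ι)
    (hA : ∀ i ∈ S, ∑ t, (w t : ℤ) * (a i t * a i t) = A)
    (hB : ∀ i ∈ S, ∀ j ∈ S, i ≠ j → ∑ t, (w t : ℤ) * (a i t * a j t) ≤ -B) :
    0 ≤ S.card * A - S.card * (S.card - 1) * B := by
  have h0 : 0 ≤ ∑ t, (w t : ℤ) * (∑ i ∈ S, a i t) ^ 2 := by positivity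
  have h1 : ∑ t, (w t : ℤ) * (∑ i ∈ S, a i t) ^ 2 =
      ∑ i ∈ S, ∑ j ∈ S, ∑ t, (w t : ℤ) * (a i t * a j t) := by
    simp_rw [pow_two, Finset.sum_mul_sum, Finset.mul_sum]
    rw [Finset.sum_comm]
    apply Finset.sum_congr rfl
    intro i _
    rw [Finset.sum_comm]
  have h2 : ∑ i ∈ S, ∑ j ∈ S, ∑ t, (w t : ℤ) * (a i t * a j t) ≤
      ∑ i ∈ S, (A - (S.card - 1) * B) := by
    apply Finset.sum_le_sum
    intro i hi
    rw [← Finset.add_sum_erase S _ hi, hA i hi]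
    have : ∑ j ∈ S.erase i, ∑ t, (w t : ℤ) * (a i t * a j t) ≤ ∑ j ∈ S.erase i, (-B) := by
      apply Finset.sum_le_sum
      intro j hj
      rw [Finset.mem_erase] at hj
      exact hB i hi j hj.2 hj.1.symm
    rw [Finset.sum_const, Finset.card_erase_of_mem hi, nsmul_eq_mul] at this
    have hc : 1 ≤ S.card := Finset.card_pos.mpr ⟨i, hi⟩
    push_cast [Nat.cast_sub hc] at this
    linarith
  rw [Finset.sum_const, nsmul_eq_mul] at h2
  linarith

lemma gram_case {k : ℕ} (hk : 2 ≤ k) (R : Set (EuclideanSpace ℝ (Fin k)))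
    (w : Fin k → ℕ) (D : ℕ) (hD : 0 < D) {n : ℕ} (hn : 0 < n) (a : Fin n → Fin k → ℤ)
    (A B : ℤ) (α m : ℕ) (hB0 : 0 < B) (hα : A < B * α) (hcard : m * α ≤ n)
    (hA : ∀ i, ∑ t, (w t : ℤ) * (a i t * a i t) = A)
    (hB : ∀ i j, i ≠ j → ∑ t, (w t : ℤ) * (a i t - a j t) ^ 2 = D ∨
      ∑ t, (w t : ℤ) * (a i t * a j t) ≤ -B)
    (hR : ∀ x ∈ R, ∀ y ∈ R, dist x y ≠ 1)
    (hl : ∀ p v : EuclideanSpace ℝ (Fin k), ‖v‖ = 1 → ∃ i < m, p + (i : ℝ) • v ∈ R) :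
    False := by
  have : Nonempty (Fin n) := ⟨⟨0, hn⟩⟩
  refine frac hk R m α (fun i => emb w D (a i)) (by simpa using hcard) ?_ hR hl
  intro S hS
  have := gram_bound w a A B S (fun i _ => hA i) (by
    intro i hi j hj hij
    rcases hB i j hij with h | h
    · exact absurd ((emb_dist w D hD _ _).2 h) (hS i hi j hj hij)
    · exact h)
  by_contra hlt
  push Not at hlt
  have hc : (α : ℤ) + 1 ≤ S.card := by exact_mod_cast hlt
  have hα0 : (0 : ℤ) ≤ α := by positivity
  have h1 : B * α ≤ (S.card - 1) * B := by nlinarith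
  have h2 : (0 : ℤ) < S.card * ((S.card - 1) * B - A) := by
    apply mul_pos <;> linarith
  linarith

/-- the half 5-cube. -/
def pt5 (x : ℕ) (i : ℕ) : ℤ :=
  if i < 4 then (if x.testBit i then -1 else 1)
  else if (x.testBit 0 ^^ x.testBit 1 ^^ x.testBit 2 ^^ x.testBit 3) then -1 else 1

/-- the 27 vertices of the Schläfli polytope. -/
def pt6 (x : ℕ) (i : ℕ) : ℤ :=
  if x < 16 then (if i < 5 then 3 * pt5 x i else 1)
  else if x < 26 then
    (if i < 5 then (if i = (x - 16) / 2 then (if x % 2 = 0 then 6 else -6) else 0) else -2)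
  else (if i < 5 then 0 else 4)

/-- the 56 vertices of the seven dimensional Gosset polytope, as signed lines of the Fano plane. -/
def pt7 (x : ℕ) (i : ℕ) : ℤ :=
  if i = x / 8 then (if x.testBit 0 then -1 else 1)
  else if i = (x / 8 + 1) % 7 then (if x.testBit 1 then -1 else 1)
  else if i = (x / 8 + 3) % 7 then (if x.testBit 2 then -1 else 1)
  else 0

lemma case5 (R : Set (EuclideanSpace ℝ (Fin 5)))
    (hR : ∀ x ∈ R, ∀ y ∈ R, dist x y ≠ 1)
    (hl : ∀ p v : EuclideanSpace ℝ (Fin 5), ‖v‖ = 1 → ∃ i : ℕ, i < 8 ∧ p + (i : ℝ) • v ∈ R) :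
    False :=
  gram_case (by norm_num) R (fun _ => 1) 8 (by norm_num) (n := 16) (by norm_num)
    (fun x i => pt5 x i) 5 3 2 8 (by norm_num) (by norm_num) (by norm_num)
    (by decide +kernel) (by decide +kernel) hR hl

lemma case6 (R : Set (EuclideanSpace ℝ (Fin 6)))
    (hR : ∀ x ∈ R, ∀ y ∈ R, dist x y ≠ 1)
    (hl : ∀ p v : EuclideanSpace ℝ (Fin 6), ‖v‖ = 1 → ∃ i : ℕ, i < 9 ∧ p + (i : ℝ) • v ∈ R) :
    False :=
  gram_case (by norm_num) R (fun i => if i < 5 then 1 else 3) 72 (by norm_num) (n := 27)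
    (by norm_num)
    (fun x i => pt6 x i) 48 24 3 9 (by norm_num) (by norm_num) (by norm_num)
    (by decide +kernel) (by decide +kernel) hR hl

lemma case7 (k : ℕ) (hk : 7 ≤ k) (hk' : k ≤ 10) (R : Set (EuclideanSpace ℝ (Fin k)))
    (hR : ∀ x ∈ R, ∀ y ∈ R, dist x y ≠ 1)
    (hl : ∀ p v : EuclideanSpace ℝ (Fin k), ‖v‖ = 1 → ∃ i < k + 3, p + (i : ℝ) • v ∈ R) :
    False := by
  refine gram_case (by omega) R (fun _ => 1) 4 (by norm_num) (n := 56) (by norm_num)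
    (fun x i => pt7 x i) 3 1 4 (k + 3) (by norm_num) (by norm_num) (by omega)
    ?_ ?_ hR hl
  · clear hR hl R
    interval_cases k <;> decide +kernel
  · clear hR hl R
    interval_cases k <;> decide +kernel

lemma oddtown {k : ℕ} (S : Finset (Finset (Fin k)))
    (h1 : ∀ s ∈ S, s.card % 2 = 1)
    (h2 : ∀ s ∈ S, ∀ t ∈ S, s ≠ t → (s ∩ t).card % 2 = 0) : S.card ≤ k := by
  classical
  let v : S → (Fin k → ZMod 2) := fun s i => if i ∈ s.1 then 1 else 0
  have hv : ∀ s t : S, v s ⬝ᵥ v t = if s = t then 1 else 0 := by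
    intro s t
    have e : v s ⬝ᵥ v t = ((s.1 ∩ t.1).card : ZMod 2) := by
      simp only [dotProduct, v, ← ite_and, mul_ite, mul_one, mul_zero]
      rw [Finset.card_eq_sum_ones, Nat.cast_sum, ← Finset.sum_filter]
      apply Finset.sum_congr
      · ext i; simp [and_comm]
      · simp
    rw [e]
    split_ifs with h
    · subst h
      rw [Finset.inter_self]
      have := h1 s.1 s.2
      rw [← Nat.cast_one, ZMod.natCast_eq_natCast_iff]
      exact this
    · have := h2 s.1 s.2 t.1 t.2 (fun h' => h (Subtype.ext h'))
      rw [← Nat.cast_zero, ZMod.natCast_eq_natCast_iff]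
      exact this
  have hli : LinearIndependent (ZMod 2) v := by
    rw [Fintype.linearIndependent_iff]
    intro g hg s
    have := congrArg (fun x => x ⬝ᵥ v s) hg
    simpa [sum_dotProduct, hv] using this
  simpa using hli.fintype_card_le_finrank

lemma case_big (k : ℕ) (hk : 11 ≤ k) (R : Set (EuclideanSpace ℝ (Fin k)))
    (hR : ∀ x ∈ R, ∀ y ∈ R, dist x y ≠ 1)
    (hl : ∀ p v : EuclideanSpace ℝ (Fin k), ‖v‖ = 1 → ∃ i < k + 3, p + (i : ℝ) • v ∈ R) :
    False := by
  classical
  have hcard : Fintype.card {s : Finset (Fin k) // s.card = 3} = k.choose 3 := by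
    rw [Fintype.card_finset_len, Fintype.card_fin]
  have hch : (k + 3) * k ≤ k.choose 3 := by
    have h := Nat.descFactorial_eq_factorial_mul_choose k 3
    obtain ⟨j, rfl⟩ : ∃ j, k = j + 11 := ⟨k - 11, by omega⟩
    simp [Nat.descFactorial, Nat.factorial] at h
    have h6 : 6 * (j + 14) ≤ (j + 9) * (j + 10) := by nlinarith
    have h7 := Nat.mul_le_mul_right (j + 11) h6
    have h8 : 6 * ((j + 11 + 3) * (j + 11)) ≤ 6 * (j + 11).choose 3 := by
      rw [← h]
      calc _ = 6 * (j + 14) * (j + 11) := by ring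
        _ ≤ _ := h7
        _ = _ := by ring
    exact Nat.le_of_mul_le_mul_left h8 (by norm_num)
  have : Nonempty {s : Finset (Fin k) // s.card = 3} := by
    rw [← Fintype.card_pos_iff, hcard]
    exact Nat.choose_pos (by omega)
  let a : Finset (Fin k) → Fin k → ℤ := fun s i => if i ∈ s then 1 else 0
  refine frac (by omega) R (k + 3) k
    (fun s : {s : Finset (Fin k) // s.card = 3} => emb (fun _ => 1) 4 (a s.1))
    (by rw [hcard]; exact hch) ?_ hR hl
  intro S hS
  rw [← Finset.card_map (Function.Embedding.subtype _)]
  apply oddtown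
  · intro s hs
    simp only [Finset.mem_map, Function.Embedding.subtype_apply] at hs
    obtain ⟨x, _, rfl⟩ := hs
    rw [x.2]
  · intro s hs t ht hst
    simp only [Finset.mem_map, Function.Embedding.subtype_apply] at hs ht
    obtain ⟨x, hx, rfl⟩ := hs
    obtain ⟨y, hy, rfl⟩ := ht
    have hd := hS x hx y hy (fun h => hst (by rw [h]))
    rw [Ne, emb_dist _ _ (by norm_num)] at hd
    have e : ∑ i, ((1 : ℕ) : ℤ) * (a x.1 i - a y.1 i) ^ 2 =
        x.1.card + y.1.card - 2 * (x.1 ∩ y.1).card := by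
      have h1 : ∀ s : Finset (Fin k), (s.card : ℤ) = ∑ i, a s i := by
        intro s; simp [a]
      rw [h1, h1, h1, Finset.mul_sum, ← Finset.sum_add_distrib, ← Finset.sum_sub_distrib]
      apply Finset.sum_congr rfl
      intro i _
      by_cases p : i ∈ x.1 <;> by_cases q : i ∈ y.1 <;> simp [a, p, q]
    rw [e, x.2, y.2] at hd
    have hle : (x.1 ∩ y.1).card ≤ 3 := by
      exact (Finset.card_le_card Finset.inter_subset_left).trans x.2.le
    have hne : (x.1 ∩ y.1).card ≠ 3 := by
      intro h
      apply hst
      have e1 : x.1 ∩ y.1 = x.1 :=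
        Finset.eq_of_subset_of_card_le Finset.inter_subset_left (by rw [h, x.2])
      have e2 : x.1 ∩ y.1 = y.1 :=
        Finset.eq_of_subset_of_card_le Finset.inter_subset_right (by rw [h, y.2])
      rw [← e1, e2]
    push_cast at hd
    omega

/-- exhaustive search for a colouring with at most `q` colours: the state is the list of
neighbourhood masks of the colour classes built so far. -/
def search (q : ℕ) : ℕ → List ℕ → List ℕ → Bool
  | _, [], _ => true
  | v, N :: rest, cls =>
    (List.range cls.length).any (fun i =>
      !(cls.getD i 0).testBit v && search q (v + 1) rest (cls.set i (cls.getD i 0 ||| N))) ||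
    (decide (cls.length < q) && search q (v + 1) rest (cls ++ [N]))

lemma search_sound (q : ℕ) (c : ℕ → ℕ) (hq : ∀ u, c u < q) :
    ∀ (rest : List ℕ) (v : ℕ) (cls cols : List ℕ),
      (∀ i < rest.length, ∀ u, (rest.getD i 0).testBit u = true → c u ≠ c (v + i)) →
      cls.length = cols.length → cols.Nodup → (∀ x ∈ cols, x < q) →
      (∀ i < cls.length, ∀ u, c u = cols.getD i 0 → (cls.getD i 0).testBit u = false) →
      search q v rest cls = true := by
  intro rest
  induction rest with
  | nil => intros; simp [search]
  | cons N rest ih =>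
    intro v cls cols hrest hlen hnd hlt hinv
    have hN : ∀ u, c u = c v → N.testBit u = false := by
      intro u hu
      by_contra h
      have := hrest 0 (by simp) u (by simpa using h)
      simp [hu] at this
    have hrest' : ∀ i < rest.length, ∀ u, (rest.getD i 0).testBit u = true →
        c u ≠ c (v + 1 + i) := by
      intro i hi u hu
      have := hrest (i + 1) (by simpa using hi) u (by simpa using hu)
      rwa [show v + (i + 1) = v + 1 + i by omega] at this
    rw [search, Bool.or_eq_true]
    by_cases hmem : c v ∈ cols
    · left
      obtain ⟨i, hi, hiv⟩ := List.getElem_of_mem hmem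
      have hiv' : cols.getD i 0 = c v := by
        rw [List.getD_eq_getElem _ _ hi, hiv]
      rw [List.any_eq_true]
      refine ⟨i, by simp; omega, ?_⟩
      rw [Bool.and_eq_true]
      constructor
      · rw [hinv i (by omega) v hiv'.symm]; rfl
      · apply ih (v + 1) _ cols hrest' (by simpa using hlen) hnd hlt
        intro j hj u hu
        rw [List.length_set] at hj
        rw [List.getD_eq_getElem _ _ (by simpa using hj), List.getElem_set]
        split_ifs with hij
        · subst hij
          rw [Nat.testBit_or, hinv i hj u hu, hN u (by rw [hu, hiv'])]
          rfl
        · rw [← List.getD_eq_getElem _ 0 hj]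
          exact hinv j hj u hu
    · right
      have hnd' : (cols ++ [c v]).Nodup := by
        rw [List.nodup_append]
        refine ⟨hnd, by simp, ?_⟩
        intro x hx y hy
        simp at hy
        rintro rfl
        exact hmem (hy ▸ hx)
      have hlt' : ∀ x ∈ cols ++ [c v], x < q := by
        intro x hx
        simp at hx
        rcases hx with hx | rfl
        · exact hlt x hx
        · exact hq v
      have hle : (cols ++ [c v]).length ≤ q := by
        have : (cols ++ [c v]).toFinset ⊆ Finset.range q := by
          intro x hx
          rw [List.mem_toFinset] at hx
          exact Finset.mem_range.2 (hlt' x hx)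
        have := Finset.card_le_card this
        rwa [List.toFinset_card_of_nodup hnd', Finset.card_range] at this
      rw [Bool.and_eq_true]
      constructor
      · simp at hle ⊢; omega
      · apply ih (v + 1) _ (cols ++ [c v]) hrest' (by simp [hlen]) hnd' hlt'
        intro j hj u hu
        simp at hj
        by_cases hjl : j < cls.length
        · rw [List.getD_append _ _ _ _ hjl]
          rw [List.getD_append _ _ _ _ (by omega)] at hu
          exact hinv j hjl u hu
        · have : j = cls.length := by omega
          subst this
          rw [List.getD_append_right _ _ _ _ le_rfl]
          rw [hlen, List.getD_append_right _ _ _ _ le_rfl] at hu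
          simp at hu ⊢
          exact hN u hu

def ptA : Fin 26 → Fin 4 → ℤ :=
  ![![0, 0, 0, 0],
    ![2, -1, 1, 0],
    ![0, 1, -1, -2],
    ![-2, -1, 1, 0],
    ![0, 1, -1, 2],
    ![0, -3, -1, -2],
    ![0, -3, -1, 2],
    ![0, -2, 0, 0],
    ![1, -1, 0, -2],
    ![1, -1, 0, 2],
    ![-1, -3, -2, 0],
    ![-1, 1, -2, 0],
    ![0, -1, -2, -1],
    ![-2, -1, -3, 0],
    ![-1, -1, -1, 1],
    ![0, -1, -2, 1],
    ![1, -2, -1, 0],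
    ![2, -1, -3, 0],
    ![-1, -1, -1, -1],
    ![0, -4, 0, 0],
    ![-2, -3, 0, 1],
    ![0, -2, 1, 1],
    ![2, -3, 0, 1],
    ![-1, -2, 0, -1],
    ![0, -1, 2, -1],
    ![-1, -3, 2, 0]]

def ptB : Fin 26 → Fin 4 → ℤ :=
  ![![0, 0, 0, 0],
    ![0, 1, 1, 0],
    ![0, 1, 1, 0],
    ![0, 1, 1, 0],
    ![0, 1, 1, 0],
    ![0, 1, 1, 0],
    ![0, 1, 1, 0],
    ![0, 2, 0, 0],
    ![1, 1, 0, 0],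
    ![1, 1, 0, 0],
    ![1, 1, 0, 0],
    ![1, 1, 0, 0],
    ![0, 1, 0, -1],
    ![0, 1, 1, 0],
    ![1, 1, 1, -1],
    ![0, 1, 0, 1],
    ![1, 0, 1, 0],
    ![0, 1, 1, 0],
    ![1, 1, 1, 1],
    ![0, 0, 0, 0],
    ![0, 1, 0, -1],
    ![0, 0, 1, -1],
    ![0, 1, 0, -1],
    ![1, 0, 0, -1],
    ![0, 1, 0, -1],
    ![1, 1, 0, 0]]

def nbrMask : List ℕ :=
  [27892510, 23266301, 407867, 53764343, 191055, 996814,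
    8119994, 55613290, 59055783, 37866963, 43908064, 325397,
    30567845, 449660, 11615832, 405201, 11421539, 110710,
    109868, 49349729, 65557704, 31014987, 20452034, 54088961,
    49287563, 26740616]

lemma no_seven : search 7 0 nbrMask [] = false := by decide +kernel

noncomputable def pt4 (x : Fin 26) : EuclideanSpace ℝ (Fin 4) :=
  WithLp.toLp 2 (fun i => ((ptA x i : ℝ) + (ptB x i : ℝ) * Real.sqrt 5) / 4)

lemma mask_ok : ∀ i u : Fin 26, (nbrMask.getD i 0).testBit u = true →
    (∑ t, ((ptA u t - ptA i t) ^ 2 + 5 * (ptB u t - ptB i t) ^ 2) = 16 ∧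
      ∑ t, (ptA u t - ptA i t) * (ptB u t - ptB i t) = 0) := by
  decide +kernel

lemma mask_lt : ∀ i < 26, nbrMask.getD i 0 < 2 ^ 26 := by decide +kernel

lemma pt4_dist (i u : Fin 26)
    (h1 : ∑ t, ((ptA u t - ptA i t) ^ 2 + 5 * (ptB u t - ptB i t) ^ 2) = 16)
    (h2 : ∑ t, (ptA u t - ptA i t) * (ptB u t - ptB i t) = 0) :
    dist (pt4 u) (pt4 i) = 1 := by
  have h1' : ∑ t, (((ptA u t : ℝ) - ptA i t) ^ 2 + 5 * ((ptB u t : ℝ) - ptB i t) ^ 2) = 16 := by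
    exact_mod_cast h1
  have h2' : ∑ t, ((ptA u t : ℝ) - ptA i t) * ((ptB u t : ℝ) - ptB i t) = 0 := by
    exact_mod_cast h2
  have h5 : Real.sqrt 5 ^ 2 = 5 := Real.sq_sqrt (by norm_num)
  rw [EuclideanSpace.dist_eq, Real.sqrt_eq_one]
  have : ∀ t, dist (pt4 u t) (pt4 i t) ^ 2 =
      (((ptA u t : ℝ) - ptA i t) ^ 2 + 5 * ((ptB u t : ℝ) - ptB i t) ^ 2) * (1 / 16) +
      (((ptA u t : ℝ) - ptA i t) * ((ptB u t : ℝ) - ptB i t)) * (Real.sqrt 5 / 8) := by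
    intro t
    simp only [pt4]
    rw [Real.dist_eq, sq_abs]
    linear_combination (((ptB u t : ℝ) - ptB i t) ^ 2 / 16) * h5
  simp_rw [this]
  rw [Finset.sum_add_distrib, ← Finset.sum_mul, ← Finset.sum_mul, h1', h2']
  norm_num

lemma case4 (R : Set (EuclideanSpace ℝ (Fin 4)))
    (hR : ∀ x ∈ R, ∀ y ∈ R, dist x y ≠ 1)
    (hl : ∀ p v : EuclideanSpace ℝ (Fin 4), ‖v‖ = 1 → ∃ i : ℕ, i < 7 ∧ p + (i : ℝ) • v ∈ R) :
    False := by
  obtain ⟨v, _, hv, _⟩ := two_dirs (k := 4) (by norm_num) 1 one_pos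
  obtain ⟨c, hc, hcc⟩ := szlam R 7 pt4 v hv hR hl
  have := search_sound 7 (fun n => if h : n < 26 then c ⟨n, h⟩ else 0)
    (by intro u; split_ifs; exacts [hc _, by norm_num])
    nbrMask 0 [] [] (by
      intro i hi u hu
      have hi' : i < 26 := hi
      have hu' : u < 26 := by
        by_contra h
        have h2 := Nat.testBit_lt_two_pow
          (lt_of_lt_of_le (mask_lt i hi') (Nat.pow_le_pow_right (by norm_num) (not_lt.1 h)))
        rw [h2] at hu
        exact absurd hu (by simp)
      obtain ⟨h1, h2⟩ := mask_ok ⟨i, hi'⟩ ⟨u, hu'⟩ hu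
      have := hcc _ _ (pt4_dist _ _ h1 h2)
      simpa [hi', hu'] using this)
    rfl List.nodup_nil (by simp) (by simp)
  rw [no_seven] at this
  exact absurd this (by simp)

/-- Main theorem: for `k ≥ 4`, `𝔼^k → (ℓ₂, ℓ_{k+3})`.  For every red-blue colouring of
`ℝ^k` (red points given by `R`), either two red points are at distance 1, or there is a
blue copy of `ℓ_{k+3}`: points `p + i • v`, `i = 0, …, k+2`, with `‖v‖ = 1`, all not in `R`. -/
theorem euclidean_ramsey_l2_lk3 (k : ℕ) (hk : 4 ≤ k)
    (R : Set (EuclideanSpace ℝ (Fin k))) :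
    (∃ x ∈ R, ∃ y ∈ R, dist x y = 1) ∨
      (∃ p v : EuclideanSpace ℝ (Fin k), ‖v‖ = 1 ∧
        ∀ i : ℕ, i ≤ k + 2 → p + (i : ℝ) • v ∉ R) := by
  by_contra hcon
  rw [not_or] at hcon
  obtain ⟨hA, hB⟩ := hcon
  have hR : ∀ x ∈ R, ∀ y ∈ R, dist x y ≠ 1 :=
    fun x hx y hy h => hA ⟨x, hx, y, hy, h⟩
  have hl : ∀ p v : EuclideanSpace ℝ (Fin k), ‖v‖ = 1 →
      ∃ i < k + 3, p + (i : ℝ) • v ∈ R := by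
    intro p v hv
    by_contra hno
    exact hB ⟨p, v, hv, fun i hi hmem => hno ⟨i, by omega, hmem⟩⟩
  rcases Nat.lt_or_ge k 7 with h | h
  · interval_cases k
    · exact case4 R hR hl
    · exact case5 R hR hl
    · exact case6 R hR hl
  · rcases Nat.lt_or_ge k 11 with h' | h'
    · exact case7 k h (by omega) R hR hl
    · exact case_big k h' R hR hl
end

section
/- Let n ≥ 3 be an integer, and let R ⊆ ℝ^n be a set of red points such that no two red points are at distance exactly 1 from each other. Let S be the sphere of radius √3/2 centred at a point O in ℝ^n. Then there exist n points on S, pairwise at distance exactly 1 from each other, none of which is red. -/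
open scoped InnerProductSpace in
/-- Two reflections carry one pair of vectors to another one with the same Gram matrix. -/
lemma exists_isometry_pair {E : Type*} [NormedAddCommGroup E] [InnerProductSpace ℝ E]
    [CompleteSpace E] (u v x z : E) (h1 : ‖u‖ = ‖x‖) (h2 : ‖v‖ = ‖z‖)
    (h3 : ⟪u, v⟫_ℝ = ⟪x, z⟫_ℝ) : ∃ T : E ≃ₗᵢ[ℝ] E, T u = x ∧ T v = z := by
  let T1 : E ≃ₗᵢ[ℝ] E := (ℝ ∙ (u - x))ᗮ.reflection
  have hT1 : T1 u = x := Submodule.reflection_sub h1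
  let T2 : E ≃ₗᵢ[ℝ] E := (ℝ ∙ (T1 v - z))ᗮ.reflection
  have hT2 : T2 (T1 v) = z := Submodule.reflection_sub (by rw [T1.norm_map, h2])
  refine ⟨T1.trans T2, ?_, hT2⟩
  show T2 (T1 u) = x
  rw [hT1]
  refine Submodule.reflection_mem_subspace_eq_self ?_
  rw [Submodule.mem_orthogonal_singleton_iff_inner_left, inner_sub_right, ← h3, ← hT1,
    T1.inner_map_map, sub_self]

open scoped InnerProductSpace in
/-- A simplex with the right Gram matrix. -/
lemma exists_model (n : ℕ) (hn : 3 ≤ n) : ∃ A : Fin n → EuclideanSpace ℝ (Fin n),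
    ∀ i j, ⟪A i, A j⟫_ℝ = if i = j then 3 / 4 else 1 / 4 := by
  have hn0 : (0 : ℝ) < n := by positivity
  obtain ⟨a, ha⟩ : ∃ a : ℝ, a ^ 2 = 1 / 2 := ⟨√(1 / 2), Real.sq_sqrt (by norm_num)⟩
  obtain ⟨c, hc⟩ : ∃ c : ℝ, c ^ 2 = 1 / 2 + n / 4 := ⟨√(1 / 2 + n / 4), Real.sq_sqrt (by positivity)⟩
  obtain ⟨b, hb⟩ : ∃ b : ℝ, 2 * a * b + n * b ^ 2 = 1 / 4 := by
    refine ⟨(c - a) / n, ?_⟩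
    field_simp
    nlinarith
  let e : Fin n → EuclideanSpace ℝ (Fin n) := fun i => EuclideanSpace.single i 1
  let s : EuclideanSpace ℝ (Fin n) := ∑ i, e i
  have hee : ∀ i j, ⟪e i, e j⟫_ℝ = if i = j then 1 else 0 := by
    intro i j
    simp [e, EuclideanSpace.inner_single_left, Pi.single_apply]
  have hes : ∀ i, ⟪e i, s⟫_ℝ = 1 := by
    intro i
    simp [s, inner_sum, hee]
  have hse : ∀ i, ⟪s, e i⟫_ℝ = 1 := by
    intro i
    rw [real_inner_comm, hes]
  have hss : ⟪s, s⟫_ℝ = n := by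
    conv_lhs => arg 2; simp only [s]
    simp [sum_inner, hes]
  refine ⟨fun i => a • e i + b • s, fun i j => ?_⟩
  simp only [inner_add_left, inner_add_right, real_inner_smul_left, real_inner_smul_right, hee, hes,
    hse, hss]
  split_ifs <;> nlinarith

open scoped InnerProductSpace in
lemma exists_three (n : ℕ) (hn : 3 ≤ n) (t : ℝ) (ht : t ^ 2 ≤ 1 / 4) :
    ∃ x y z : EuclideanSpace ℝ (Fin n), ⟪x, x⟫_ℝ = 3 / 4 ∧ ⟪y, y⟫_ℝ = 3 / 4 ∧ ⟪z, z⟫_ℝ = 3 / 4 ∧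
      ⟪x, y⟫_ℝ = 1 / 4 ∧ ⟪x, z⟫_ℝ = t ∧ ⟪z, y⟫_ℝ = t := by
  obtain ⟨p, hp⟩ : ∃ p : ℝ, p ^ 2 = 1 / 2 := ⟨√(1 / 2), Real.sq_sqrt (by norm_num)⟩
  obtain ⟨w, hw⟩ : ∃ w : ℝ, w ^ 2 = 3 / 4 - 2 * t ^ 2 := ⟨√_, Real.sq_sqrt (by linarith)⟩
  let e : Fin n → EuclideanSpace ℝ (Fin n) := fun i => EuclideanSpace.single i 1
  have hee : ∀ i j, ⟪e i, e j⟫_ℝ = if i = j then 1 else 0 := by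
    intro i j
    simp [e, EuclideanSpace.inner_single_left, Pi.single_apply]
  let i0 : Fin n := ⟨0, by omega⟩
  let i1 : Fin n := ⟨1, by omega⟩
  let i2 : Fin n := ⟨2, by omega⟩
  have h01 : i0 ≠ i1 := by simp [i0, i1]
  have h02 : i0 ≠ i2 := by simp [i0, i2]
  have h12 : i1 ≠ i2 := by simp [i1, i2]
  refine ⟨p • e i0 + (1 / 2 : ℝ) • e i1, p • e i0 + (-1 / 2 : ℝ) • e i1,
    (2 * t * p) • e i0 + w • e i2, ?_⟩
  simp only [inner_add_left, inner_add_right, real_inner_smul_left, real_inner_smul_right, hee,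
    h01, h02, h12, h01.symm, h02.symm, h12.symm, if_true, if_false]
  refine ⟨?_, ?_, ?_, ?_, ?_, ?_⟩
  · nlinarith
  · nlinarith
  · linear_combination 4 * t ^ 2 * hp + hw
  · nlinarith
  · linear_combination 2 * t * hp
  · linear_combination 2 * t * hp

open scoped InnerProductSpace in
lemma norm_eq_of_inner {E : Type*} [NormedAddCommGroup E] [InnerProductSpace ℝ E] {x : E}
    (h : ⟪x, x⟫_ℝ = 3 / 4) : ‖x‖ = √3 / 2 := by
  rw [norm_eq_sqrt_real_inner, h, Real.sqrt_div (by norm_num)]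
  congr 1
  rw [show (4 : ℝ) = 2 ^ 2 by norm_num]
  exact Real.sqrt_sq (by norm_num)

open scoped InnerProductSpace in
lemma dist_eq_of_inner {E : Type*} [NormedAddCommGroup E] [InnerProductSpace ℝ E] {x y : E}
    (hx : ⟪x, x⟫_ℝ = 3 / 4) (hy : ⟪y, y⟫_ℝ = 3 / 4) (h : ⟪x, y⟫_ℝ = 1 / 4) : dist x y = 1 := by
  rw [dist_eq_norm, norm_eq_sqrt_real_inner, real_inner_sub_sub_self, hx, hy, h]
  norm_num

/-- Lemma 2.2: if no two red points of `ℝ^n` (`n ≥ 3`) are at distance 1, then any sphere of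
radius `√3/2` contains `n` pairwise unit-distance points, all blue. -/
theorem blue_simplex_on_sphere (n : ℕ) (hn : 3 ≤ n)
    (R : Set (EuclideanSpace ℝ (Fin n)))
    (hR : ¬∃ x ∈ R, ∃ y ∈ R, dist x y = 1)
    (O : EuclideanSpace ℝ (Fin n)) :
    ∃ A : Fin n → EuclideanSpace ℝ (Fin n),
      (∀ i, A i ∈ Metric.sphere O (Real.sqrt 3 / 2)) ∧
      (∀ i j, i ≠ j → dist (A i) (A j) = 1) ∧
      (∀ i, A i ∉ R) := by
  by_contra hcon
  -- every simplex has a red vertex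
  have hred : ∀ A : Fin n → EuclideanSpace ℝ (Fin n),
      (∀ i j, inner ℝ (A i) (A j) = if i = j then (3 / 4 : ℝ) else 1 / 4) →
      ∃ i, O + A i ∈ R := by
    intro A hA
    by_contra! h
    refine hcon ⟨fun i => O + A i, fun i => ?_, fun i j hij => ?_, h⟩
    · simp [norm_eq_of_inner (x := A i) (by rw [hA, if_pos rfl])]
    · rw [dist_add_left]
      exact dist_eq_of_inner (by rw [hA, if_pos rfl]) (by rw [hA, if_pos rfl]) (by rw [hA, if_neg hij])
  have hblue : ∀ x y : EuclideanSpace ℝ (Fin n), inner ℝ x x = (3 / 4 : ℝ) →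
      inner ℝ y y = (3 / 4 : ℝ) → inner ℝ x y = (1 / 4 : ℝ) → O + x ∈ R → O + y ∉ R := by
    intro x y hx hy hxy hxR hyR
    exact hR ⟨_, hxR, _, hyR, by rw [dist_add_left]; exact dist_eq_of_inner hx hy hxy⟩
  obtain ⟨A, hA⟩ := exists_model n hn
  obtain ⟨k, hk⟩ := hred A hA
  have hn1 : (0 : ℝ) < n + 1 := by positivity
  set t : ℝ := -(n + 5) / (4 * (n + 1)) with ht
  -- the mirror image of `A k`
  set S := ∑ j ∈ Finset.univ.erase k, A j with hS
  have hcard : (((Finset.univ : Finset (Fin n)).erase k).card : ℝ) = n - 1 := by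
    rw [Finset.card_erase_of_mem (Finset.mem_univ _), Finset.card_univ, Fintype.card_fin,
      Nat.cast_sub (by omega)]
    simp
  have hkS : inner ℝ (A k) S = ((n : ℝ) - 1) / 4 := by
    rw [hS, inner_sum, Finset.sum_congr rfl (g := fun _ => (1 / 4 : ℝ))]
    · rw [Finset.sum_const, nsmul_eq_mul, hcard]; ring
    · intro j hj
      rw [hA, if_neg (Finset.ne_of_mem_erase hj).symm]
  have hiS : ∀ i, i ≠ k → inner ℝ (A i) S = ((n : ℝ) + 1) / 4 := by
    intro i hi
    rw [hS, inner_sum, Finset.sum_congr rfl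
      (g := fun j => (1 / 4 : ℝ) + if i = j then 1 / 2 else 0)]
    · rw [Finset.sum_add_distrib, Finset.sum_const, nsmul_eq_mul, hcard, Finset.sum_ite_eq,
        if_pos (by simp [hi])]
      ring
    · intro j hj
      rw [hA]
      split_ifs <;> norm_num
  have hSS : inner ℝ S S = ((n : ℝ) - 1) * (n + 1) / 4 := by
    conv_lhs => arg 2; rw [hS]
    rw [sum_inner, Finset.sum_congr rfl (g := fun _ => ((n : ℝ) + 1) / 4)]
    · rw [Finset.sum_const, nsmul_eq_mul, hcard]; ring
    · intro j hj
      exact hiS j (Finset.ne_of_mem_erase hj)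
  set v := (2 / ((n : ℝ) + 1)) • S - A k with hv
  have hkk : inner ℝ (A k) (A k) = (3 / 4 : ℝ) := by rw [hA, if_pos rfl]
  have hvk : inner ℝ (A k) v = t := by
    rw [hv, inner_sub_right, real_inner_smul_right, hkS, hkk, ht]
    field_simp
    ring
  have hvi : ∀ i, i ≠ k → inner ℝ v (A i) = (1 / 4 : ℝ) := by
    intro i hi
    rw [real_inner_comm, hv, inner_sub_right, real_inner_smul_right, hiS i hi, hA, if_neg hi]
    field_simp
    ring
  have hvv : inner ℝ v v = (3 / 4 : ℝ) := by
    rw [hv, real_inner_sub_sub_self, real_inner_smul_right, real_inner_smul_left,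
      real_inner_smul_left, real_inner_comm (A k) S, hkS, hkk, hSS]
    field_simp
    ring
  -- red propagates
  have hprop : ∀ x z : EuclideanSpace ℝ (Fin n), inner ℝ x x = (3 / 4 : ℝ) →
      inner ℝ z z = (3 / 4 : ℝ) → inner ℝ x z = t → O + x ∈ R → O + z ∈ R := by
    intro x z hx hz hxz hxR
    obtain ⟨T, hTx, hTz⟩ := exists_isometry_pair (A k) v x z
      (by rw [norm_eq_of_inner hkk, norm_eq_of_inner hx])
      (by rw [norm_eq_of_inner hvv, norm_eq_of_inner hz]) (by rw [hvk, hxz])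
    obtain ⟨i, hi⟩ := hred (fun i => T (if i = k then v else A i)) (by
      intro i j
      rw [T.inner_map_map]
      by_cases hi : i = k <;> by_cases hj : j = k
      · rw [if_pos hi, if_pos hj, hvv, if_pos (hi.trans hj.symm)]
      · rw [if_pos hi, if_neg hj, hvi j hj, if_neg (by rw [hi]; exact Ne.symm hj)]
      · rw [if_neg hi, if_pos hj, real_inner_comm, hvi i hi, if_neg (by rw [hj]; exact hi)]
      · rw [if_neg hi, if_neg hj, hA])
    by_cases hik : i = k
    · simpa [hik, hTz] using hi
    · simp only [if_neg hik] at hi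
      refine absurd hi (hblue x _ hx ?_ ?_ hxR)
      · rw [T.inner_map_map, hA, if_pos rfl]
      · rw [← hTx, T.inner_map_map, hA, if_neg (Ne.symm hik)]
  have ht2 : t ^ 2 ≤ 1 / 4 := by
    have h3 : (3 : ℝ) ≤ n := by exact_mod_cast hn
    have : |t| ≤ 1 / 2 := by
      rw [ht, abs_le]
      constructor
      · rw [le_div_iff₀ (by positivity)]; linarith
      · rw [div_le_iff₀ (by positivity)]; linarith
    rw [← sq_abs]
    nlinarith [abs_nonneg t]
  obtain ⟨x, y, z, hx, hy, hz, hxy, hxz, hzy⟩ := exists_three n hn t ht2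
  obtain ⟨T, hT, -⟩ := exists_isometry_pair x x (A k) (A k)
    (by rw [norm_eq_of_inner hkk, norm_eq_of_inner hx])
    (by rw [norm_eq_of_inner hkk, norm_eq_of_inner hx]) (by rw [hkk, hx])
  have hTi := T.inner_map_map
  have h1 : O + T x ∈ R := by rw [hT]; exact hk
  have h2 := hprop (T x) (T z) (by rw [hTi, hx]) (by rw [hTi, hz]) (by rw [hTi, hxz]) h1
  have h3 := hprop (T z) (T y) (by rw [hTi, hz]) (by rw [hTi, hy]) (by rw [hTi, hzy]) h2
  exact hblue (T x) (T y) (by rw [hTi, hx]) (by rw [hTi, hy]) (by rw [hTi, hxy]) h1 h3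
end
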